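/- (Pinching achieves the relative entropy asymptotically.) (1/n) D(E_{σ_n}(ρ_n) ‖ σ_n) → D(ρ‖σ) as n → ∞, where E_{σ_n}(ρ_n) is the pinching of ρ_n by σ_n. -/

import Mathlib

open Matrix Filter
open scoped ComplexOrder

noncomputable section

/-- Functional calculus for a Hermitian matrix: apply `f` to the eigenvalues. -/
def matFun {m : Type*} [Fintype m] [DecidableEq m] (f : ℝ → ℝ) (A : Matrix m m ℂ) :
    Matrix m m ℂ :=
  if hA : A.IsHermitian then
    (hA.eigenvectorUnitary : Matrix m m ℂ) *
      Matrix.diagonal (fun i => (f (hA.eigenvalues i) : ℂ)) *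
      star (hA.eigenvectorUnitary : Matrix m m ℂ)
  else 0

/-- Matrix logarithm (via functional calculus). -/
def matLog {m : Type*} [Fintype m] [DecidableEq m] (A : Matrix m m ℂ) : Matrix m m ℂ :=
  matFun Real.log A

/-- Real matrix power (via functional calculus). -/
def matRPow {m : Type*} [Fintype m] [DecidableEq m] (A : Matrix m m ℂ) (s : ℝ) :
    Matrix m m ℂ :=
  matFun (fun x => x ^ s) A

open Classical in
/-- The finite set of (distinct, real) eigenvalues of a Hermitian matrix. -/
def eigFinset {m : Type*} [Fintype m] [DecidableEq m] (A : Matrix m m ℂ) : Finset ℝ :=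
  if hA : A.IsHermitian then Finset.image hA.eigenvalues Finset.univ else ∅

/-- `v A`: the number of distinct eigenvalues of a Hermitian matrix `A`. -/
def numEig {m : Type*} [Fintype m] [DecidableEq m] (A : Matrix m m ℂ) : ℕ :=
  (eigFinset A).card

/-- The spectral projection of a Hermitian matrix `A` corresponding to eigenvalue `μ`. -/
def specProj {m : Type*} [Fintype m] [DecidableEq m] (A : Matrix m m ℂ) (μ : ℝ) :
    Matrix m m ℂ :=
  matFun (fun x => if x = μ then 1 else 0) A

/-- The pinching `E_A(B) = Σ_i E_i B E_i` of `B` by the Hermitian matrix `A`. -/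
def pinch {m : Type*} [Fintype m] [DecidableEq m] (A B : Matrix m m ℂ) : Matrix m m ℂ :=
  ∑ μ ∈ eigFinset A, specProj A μ * B * specProj A μ

/-- `{X > 0}`: the projection onto the strictly positive eigenspaces of a Hermitian `X`. -/
def posProj {m : Type*} [Fintype m] [DecidableEq m] (X : Matrix m m ℂ) : Matrix m m ℂ :=
  matFun (fun x => if 0 < x then 1 else 0) X

/-- The `n`-fold tensor (Kronecker) power of a `d × d` matrix, realized on the index type
`Fin n → Fin d`. -/
def tensorPow {d : ℕ} (ρ : Matrix (Fin d) (Fin d) ℂ) (n : ℕ) :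
    Matrix (Fin n → Fin d) (Fin n → Fin d) ℂ :=
  fun x y => ∏ i, ρ (x i) (y i)

/-- A density matrix: positive semidefinite with unit trace. -/
def IsDensity {m : Type*} [Fintype m] [DecidableEq m] (ρ : Matrix m m ℂ) : Prop :=
  ρ.PosSemidef ∧ ρ.trace = 1

/-- A test: an operator `A` with `0 ≤ A ≤ I` in the Loewner order. -/
def IsTest {m : Type*} [Fintype m] [DecidableEq m] (A : Matrix m m ℂ) : Prop :=
  A.PosSemidef ∧ (1 - A).PosSemidef

/-- The quantum relative entropy `D(ρ‖σ) = Tr[ρ (log ρ − log σ)]`. -/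
def relEnt {m : Type*} [Fintype m] [DecidableEq m] (ρ σ : Matrix m m ℂ) : ℝ :=
  ((ρ * (matLog ρ - matLog σ)).trace).re

/-- The error probability of the first kind, `α_n(A) = Tr[ρ_n (I − A)]`. -/
def alphaErr {d : ℕ} (ρ : Matrix (Fin d) (Fin d) ℂ) (n : ℕ)
    (A : Matrix (Fin n → Fin d) (Fin n → Fin d) ℂ) : ℝ :=
  ((tensorPow ρ n * (1 - A)).trace).re

/-- The error probability of the second kind, `β_n(A) = Tr[σ_n A]`. -/
def betaErr {d : ℕ} (σ : Matrix (Fin d) (Fin d) ℂ) (n : ℕ)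
    (A : Matrix (Fin n → Fin d) (Fin n → Fin d) ℂ) : ℝ :=
  ((tensorPow σ n * A).trace).re

/-- `β*_n(ε)`: the minimum type-II error among tests with type-I error at most `ε`. -/
def betaStar {d : ℕ} (ρ σ : Matrix (Fin d) (Fin d) ℂ) (n : ℕ) (ε : ℝ) : ℝ :=
  sInf {b : ℝ | ∃ A : Matrix (Fin n → Fin d) (Fin n → Fin d) ℂ,
    IsTest A ∧ alphaErr ρ n A ≤ ε ∧ b = betaErr σ n A}


/-! ### Spectral form -/

/-- `U diag(a) Uᴴ`. -/
def specForm {m : Type*} [Fintype m] [DecidableEq m] (U : Matrix m m ℂ) (a : m → ℝ) :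
    Matrix m m ℂ :=
  U * Matrix.diagonal (fun i => (a i : ℂ)) * Uᴴ

section Helpers

variable {m : Type*} [Fintype m] [DecidableEq m]

lemma specForm_isHermitian (U : Matrix m m ℂ) (a : m → ℝ) : (specForm U a).IsHermitian := by
  unfold specForm
  apply Matrix.isHermitian_mul_mul_conjTranspose
  apply Matrix.isHermitian_diagonal_of_self_adjoint
  ext i
  simp

lemma matFun_eq {A : Matrix m m ℂ} (hA : A.IsHermitian) (f : ℝ → ℝ) :
    matFun f A = specForm (hA.eigenvectorUnitary : Matrix m m ℂ)
      (fun i => f (hA.eigenvalues i)) := by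
  rw [matFun, dif_pos hA]; rfl

lemma eq_specForm {A : Matrix m m ℂ} (hA : A.IsHermitian) :
    A = specForm (hA.eigenvectorUnitary : Matrix m m ℂ) hA.eigenvalues := by
  conv_lhs => rw [hA.spectral_theorem, Unitary.conjStarAlgAut_apply]
  rfl

lemma eigU_mul {A : Matrix m m ℂ} (hA : A.IsHermitian) :
    (hA.eigenvectorUnitary : Matrix m m ℂ) * (hA.eigenvectorUnitary : Matrix m m ℂ)ᴴ = 1 :=
  Unitary.coe_mul_star_self _

/-- Intertwining lemma. -/
lemma intertwine {U V X : Matrix m m ℂ} (hU : U * Uᴴ = 1) (hV : V * Vᴴ = 1) (a b : m → ℝ)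
    (h : X * specForm U a = specForm V b * X) (f : ℝ → ℝ) :
    X * specForm U (fun i => f (a i)) = specForm V (fun i => f (b i)) * X := by
  have hU' : Uᴴ * U = 1 := mul_eq_one_comm.mp hU
  have hV' : Vᴴ * V = 1 := mul_eq_one_comm.mp hV
  have key : ∀ c e : m → ℝ, (X * specForm U c = specForm V e * X ↔
      (Vᴴ * X * U) * Matrix.diagonal (fun i => (c i : ℂ)) =
        Matrix.diagonal (fun i => (e i : ℂ)) * (Vᴴ * X * U)) := by
    intro c e
    unfold specForm
    constructor
    · intro h
      calc _ = Vᴴ * (X * (U * Matrix.diagonal (fun i => (c i : ℂ)) * Uᴴ)) * U := by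
            simp only [Matrix.mul_assoc, hU', Matrix.mul_one]
        _ = _ := by
            rw [h]; simp only [← Matrix.mul_assoc, hV', Matrix.one_mul]
    · intro h
      calc _ = V * (Vᴴ * X * U * Matrix.diagonal (fun i => (c i : ℂ))) * Uᴴ := by
            simp only [← Matrix.mul_assoc, hV, Matrix.one_mul]
        _ = _ := by
            rw [h]; simp only [Matrix.mul_assoc, hU, Matrix.mul_one]
  rw [key] at h ⊢
  ext i j
  have := congrFun (congrFun h i) j
  rw [Matrix.mul_diagonal, Matrix.diagonal_mul] at this ⊢
  by_cases hab : a j = b i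
  · rw [hab, mul_comm]
  · have : (Vᴴ * X * U) i j = 0 := by
      have h2 : ((a j : ℂ) - b i) * (Vᴴ * X * U) i j = 0 := by linear_combination this
      rcases mul_eq_zero.mp h2 with h3 | h3
      · exact absurd (by exact_mod_cast sub_eq_zero.mp h3) hab
      · exact h3
    rw [this]; simp

lemma matFun_specForm {U : Matrix m m ℂ} (hU : U * Uᴴ = 1) (a : m → ℝ) (f : ℝ → ℝ) :
    matFun f (specForm U a) = specForm U (fun i => f (a i)) := by
  have hA := specForm_isHermitian U a
  rw [matFun_eq hA]
  have := intertwine (X := 1) (eigU_mul hA) hU hA.eigenvalues a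
    (by rw [← eq_specForm hA]; simp) f
  simpa using this

lemma commute_matFun {A X : Matrix m m ℂ} (hA : A.IsHermitian) (h : X * A = A * X)
    (f : ℝ → ℝ) : X * matFun f A = matFun f A * X := by
  rw [matFun_eq hA]
  apply intertwine (eigU_mul hA) (eigU_mul hA)
  rwa [← eq_specForm hA]

lemma specForm_mul {U : Matrix m m ℂ} (hU : U * Uᴴ = 1) (a b : m → ℝ) :
    specForm U a * specForm U b = specForm U (fun i => a i * b i) := by
  have hU' : Uᴴ * U = 1 := mul_eq_one_comm.mp hU
  unfold specForm
  calc _ = U * Matrix.diagonal (fun i => (a i : ℂ)) * (Uᴴ * U) *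
        Matrix.diagonal (fun i => (b i : ℂ)) * Uᴴ := by simp only [Matrix.mul_assoc]
    _ = _ := by
      rw [hU', Matrix.mul_one, Matrix.mul_assoc U, Matrix.diagonal_mul_diagonal]
      simp

lemma specForm_posDef {U : Matrix m m ℂ} (hU : U * Uᴴ = 1) (a : m → ℝ) (ha : ∀ i, 0 < a i) :
    (specForm U a).PosDef := by
  have hU' : Uᴴ * U = 1 := mul_eq_one_comm.mp hU
  have hd : (Matrix.diagonal (fun i => (a i : ℂ))).PosDef := by
    rw [Matrix.posDef_diagonal_iff]
    intro i
    exact_mod_cast ha i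
  unfold specForm
  apply hd.mul_mul_conjTranspose_same
  intro x y hxy
  have h1 : (x ᵥ* U) ᵥ* Uᴴ = (y ᵥ* U) ᵥ* Uᴴ := by
    simp only at hxy
    rw [hxy]
  simpa [Matrix.vecMul_vecMul, hU] using h1

lemma eigFinset_subset {U : Matrix m m ℂ} (hU : U * Uᴴ = 1) (a : m → ℝ) {t : ℝ}
    (ht : t ∈ eigFinset (specForm U a)) : ∃ j, a j = t := by
  classical
  have hA := specForm_isHermitian U a
  rw [eigFinset, dif_pos hA] at ht
  obtain ⟨i, -, hi⟩ := Finset.mem_image.mp ht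
  by_contra hne
  push Not at hne
  have h1 : matFun (fun x => if x = t then 1 else 0) (specForm U a) = 0 := by
    rw [matFun_specForm hU]
    simp [hne, specForm]
  rw [matFun_eq hA] at h1
  set V := (hA.eigenvectorUnitary : Matrix m m ℂ)
  have hV : V * Vᴴ = 1 := eigU_mul hA
  have hV' : Vᴴ * V = 1 := mul_eq_one_comm.mp hV
  rw [specForm] at h1
  have h2 := congrArg (fun M => Vᴴ * M * V) h1
  simp only [← Matrix.mul_assoc, hV', Matrix.one_mul] at h2
  rw [Matrix.mul_assoc, hV', Matrix.mul_one] at h2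
  have h3 := congrFun (congrFun h2 i) i
  simp [hi] at h3

/-! ### Pinching -/

lemma specProj_herm {A : Matrix m m ℂ} (hA : A.IsHermitian) (t : ℝ) :
    (specProj A t)ᴴ = specProj A t := by
  rw [specProj, matFun_eq hA]
  exact specForm_isHermitian _ _

lemma specProj_idem {A : Matrix m m ℂ} (hA : A.IsHermitian) (t : ℝ) :
    specProj A t * specProj A t = specProj A t := by
  rw [specProj, matFun_eq hA, specForm_mul (eigU_mul hA)]
  congr 1
  ext i
  split_ifs <;> simp

lemma specProj_orth {A : Matrix m m ℂ} (hA : A.IsHermitian) {s t : ℝ} (hst : s ≠ t) :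
    specProj A s * specProj A t = 0 := by
  rw [specProj, specProj, matFun_eq hA, matFun_eq hA, specForm_mul (eigU_mul hA)]
  have : ∀ i, ((if hA.eigenvalues i = s then (1 : ℝ) else 0) *
      if hA.eigenvalues i = t then 1 else 0) = 0 := by
    intro i
    split_ifs <;> simp_all
  simp only [this]
  simp [specForm]

lemma specProj_sum {A : Matrix m m ℂ} (hA : A.IsHermitian) :
    ∑ t ∈ eigFinset A, specProj A t = 1 := by
  classical
  have h : ∀ t, specProj A t = specForm (hA.eigenvectorUnitary : Matrix m m ℂ)
      (fun i => if hA.eigenvalues i = t then 1 else 0) := fun t => by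
    rw [specProj, matFun_eq hA]
  simp only [h, specForm]
  rw [← Finset.sum_mul, ← Finset.mul_sum]
  have : ∑ t ∈ eigFinset A, Matrix.diagonal
      (fun i => (((if hA.eigenvalues i = t then 1 else 0 : ℝ)) : ℂ)) = 1 := by
    ext i j
    rw [Matrix.sum_apply]
    by_cases hij : i = j
    · subst hij
      simp [eigFinset, hA, apply_ite]
    · simp [hij]
  rw [this, Matrix.mul_one, eigU_mul hA]

lemma pinch_comm {A : Matrix m m ℂ} (hA : A.IsHermitian) (B : Matrix m m ℂ) {t : ℝ}
    (ht : t ∈ eigFinset A) : specProj A t * pinch A B = pinch A B * specProj A t := by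
  rw [pinch, Finset.mul_sum, Finset.sum_mul, Finset.sum_eq_single_of_mem t ht,
    Finset.sum_eq_single_of_mem t ht]
  · rw [Matrix.mul_assoc _ (specProj A t) (specProj A t), specProj_idem hA]
    simp only [← Matrix.mul_assoc]
    rw [specProj_idem hA]
  · intro s _ hs
    rw [Matrix.mul_assoc, specProj_orth hA hs, Matrix.mul_zero]
  · intro s _ hs
    rw [← Matrix.mul_assoc, ← Matrix.mul_assoc, specProj_orth hA hs.symm, Matrix.zero_mul,
      Matrix.zero_mul]

lemma trace_pinch_mul {A : Matrix m m ℂ} (hA : A.IsHermitian) (B X : Matrix m m ℂ)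
    (hX : ∀ t ∈ eigFinset A, specProj A t * X = X * specProj A t) :
    (pinch A B * X).trace = (B * X).trace := by
  rw [pinch, Finset.sum_mul, Matrix.trace_sum]
  have : ∀ t ∈ eigFinset A, (specProj A t * B * specProj A t * X).trace =
      (B * X * specProj A t).trace := by
    intro t ht
    calc _ = (specProj A t * (B * specProj A t * X)).trace := by simp only [Matrix.mul_assoc]
      _ = (B * (specProj A t * X) * specProj A t).trace := by
        rw [Matrix.trace_mul_comm]; simp only [Matrix.mul_assoc]
      _ = _ := by
        rw [hX t ht]; simp only [Matrix.mul_assoc]; rw [specProj_idem hA]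
  rw [Finset.sum_congr rfl this, ← Matrix.trace_sum, ← Finset.mul_sum, specProj_sum hA,
    Matrix.mul_one]

lemma pinch_ineq {A B : Matrix m m ℂ} (hA : A.IsHermitian) (hB : B.PosSemidef) :
    (((numEig A : ℝ) : ℂ) • pinch A B - B).PosSemidef := by
  have h1 : (∑ s ∈ eigFinset A, ∑ t ∈ eigFinset A,
      (specProj A s - specProj A t) * B * (specProj A s - specProj A t)ᴴ).PosSemidef :=
    Matrix.posSemidef_sum _ fun s _ => Matrix.posSemidef_sum _ fun t _ =>
      hB.mul_mul_conjTranspose_same _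
  have h2 : (∑ s ∈ eigFinset A, ∑ t ∈ eigFinset A,
      (specProj A s - specProj A t) * B * (specProj A s - specProj A t)ᴴ) =
      (2 : ℂ) • (((numEig A : ℝ) : ℂ) • pinch A B - B) := by
    have e : ∀ s t, (specProj A s - specProj A t) * B * (specProj A s - specProj A t)ᴴ =
        specProj A s * B * specProj A s + specProj A t * B * specProj A t
        - specProj A s * (B * specProj A t) - specProj A t * (B * specProj A s) := by
      intro s t
      rw [Matrix.conjTranspose_sub, specProj_herm hA, specProj_herm hA]
      noncomm_ring
    simp only [e, Finset.sum_sub_distrib, Finset.sum_add_distrib, ← Finset.mul_sum,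
      ← Finset.sum_mul, specProj_sum hA]
    simp only [Finset.sum_const, Matrix.mul_smul, ← Finset.smul_sum, Matrix.mul_one,
      Matrix.one_mul]
    change (eigFinset A).card • pinch A B + (eigFinset A).card • pinch A B - B - B = _
    rw [two_smul, numEig]
    simp only [Complex.ofReal_natCast, Nat.cast_smul_eq_nsmul]
    abel
  rw [h2] at h1
  have := h1.smul (α := ℂ) (a := (1 / 2 : ℂ)) (by norm_num [Complex.le_def])
  rwa [smul_smul, one_div, inv_mul_cancel₀ two_ne_zero, one_smul] at this

lemma pinch_posDef {A B : Matrix m m ℂ} (hA : A.IsHermitian) (hB : B.PosDef)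
    (hv : 0 < numEig A) : (pinch A B).PosDef := by
  have h := hB.add_posSemidef (pinch_ineq hA hB.posSemidef)
  rw [add_sub_cancel] at h
  have h3 := h.smul (α := ℂ) (a := (((numEig A : ℝ)⁻¹ : ℝ) : ℂ))
    (by
      have : (0:ℝ) < (numEig A : ℝ)⁻¹ := by positivity
      exact_mod_cast this)
  rwa [smul_smul, ← Complex.ofReal_mul, inv_mul_cancel₀ (by positivity), Complex.ofReal_one,
    one_smul] at h3

/-! ### Trace inequalities -/

lemma trace_specForm_mul (U V : Matrix m m ℂ) (a b : m → ℝ) :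
    ((specForm U a * specForm V b).trace).re =
      ∑ i, ∑ j, a i * b j * Complex.normSq ((Uᴴ * V) i j) := by
  have h : (specForm U a * specForm V b).trace = (Matrix.diagonal (fun i => (a i : ℂ)) *
      (Uᴴ * V) * (Matrix.diagonal (fun i => (b i : ℂ)) * (Uᴴ * V)ᴴ)).trace := by
    unfold specForm
    rw [Matrix.conjTranspose_mul, Matrix.conjTranspose_conjTranspose]
    simp only [Matrix.mul_assoc]
    rw [Matrix.trace_mul_comm]
    simp only [Matrix.mul_assoc]
  rw [h, Matrix.trace, Complex.re_sum]
  apply Finset.sum_congr rfl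
  intro i _
  rw [Matrix.diag_apply, Matrix.mul_apply, Complex.re_sum]
  apply Finset.sum_congr rfl
  intro j _
  rw [Matrix.diagonal_mul, Matrix.diagonal_mul, Matrix.conjTranspose_apply]
  have : (a i : ℂ) * (Uᴴ * V) i j * ((b j : ℂ) * star ((Uᴴ * V) i j)) =
      ((a i * b j * Complex.normSq ((Uᴴ * V) i j) : ℝ) : ℂ) := by
    push_cast
    rw [Complex.normSq_eq_conj_mul_self]
    simp only [Complex.star_def]
    ring
  rw [this, Complex.ofReal_re]

lemma specForm_one {U : Matrix m m ℂ} (hU : U * Uᴴ = 1) : specForm U (fun _ => 1) = 1 := by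
  simp [specForm, hU]

/-- Klein's inequality. -/
lemma klein {A B : Matrix m m ℂ} (hA : A.PosDef) (hB : B.PosDef) :
    A.trace.re - B.trace.re ≤ ((A * matLog A).trace).re - ((A * matLog B).trace).re := by
  set U := (hA.1.eigenvectorUnitary : Matrix m m ℂ)
  set V := (hB.1.eigenvectorUnitary : Matrix m m ℂ)
  set a := hA.1.eigenvalues with ha
  set b := hB.1.eigenvalues with hb
  have hU : U * Uᴴ = 1 := eigU_mul hA.1
  have hV : V * Vᴴ = 1 := eigU_mul hB.1
  have eA : A = specForm U a := eq_specForm hA.1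
  have eB : B = specForm V b := eq_specForm hB.1
  have lA : matLog A = specForm U (fun i => Real.log (a i)) := matFun_eq hA.1 _
  have lB : matLog B = specForm V (fun i => Real.log (b i)) := matFun_eq hB.1 _
  have h1 : A.trace.re = ∑ i, ∑ j, a i * 1 * Complex.normSq ((Uᴴ * V) i j) := by
    rw [← trace_specForm_mul, specForm_one hV, Matrix.mul_one, ← eA]
  have h2 : B.trace.re = ∑ i, ∑ j, 1 * b j * Complex.normSq ((Uᴴ * V) i j) := by
    rw [← trace_specForm_mul, specForm_one hU, Matrix.one_mul, ← eB]
  have h3 : ((A * matLog A).trace).re =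
      ∑ i, ∑ j, a i * Real.log (a i) * 1 * Complex.normSq ((Uᴴ * V) i j) := by
    rw [← trace_specForm_mul, specForm_one hV, Matrix.mul_one, lA]
    conv_lhs => rw [eA]
    rw [specForm_mul hU]
  have h4 : ((A * matLog B).trace).re =
      ∑ i, ∑ j, a i * Real.log (b j) * Complex.normSq ((Uᴴ * V) i j) := by
    rw [← trace_specForm_mul, ← eA, lB]
  rw [h1, h2, h3, h4]
  simp only [← Finset.sum_sub_distrib]
  apply Finset.sum_le_sum; intro i _
  apply Finset.sum_le_sum; intro j _
  have hai : 0 < a i := hA.eigenvalues_pos i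
  have hbj : 0 < b j := hB.eigenvalues_pos j
  have hl : Real.log (b j) - Real.log (a i) ≤ b j / a i - 1 := by
    rw [← Real.log_div hbj.ne' hai.ne']
    exact Real.log_le_sub_one_of_pos (by positivity)
  have hl2 : a i - b j ≤ a i * Real.log (a i) - a i * Real.log (b j) := by
    have := mul_le_mul_of_nonneg_left hl hai.le
    have e : a i * (b j / a i - 1) = b j - a i := by field_simp
    linarith
  nlinarith [mul_le_mul_of_nonneg_right hl2 (Complex.normSq_nonneg ((Uᴴ * V) i j))]

/-- The reverse bound: if `A ≤ v B` then `Tr A log A ≤ Tr A log B + Tr A log v`. -/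
lemma upper_of_le {A B : Matrix m m ℂ} (hA : A.PosDef) (hB : B.PosDef) {v : ℝ} (hv : 0 < v)
    (hAB : ((v : ℂ) • B - A).PosSemidef) :
    ((A * matLog A).trace).re - ((A * matLog B).trace).re ≤ A.trace.re * Real.log v := by
  set U := (hA.1.eigenvectorUnitary : Matrix m m ℂ)
  set V := (hB.1.eigenvectorUnitary : Matrix m m ℂ)
  set a := hA.1.eigenvalues with ha
  set b := hB.1.eigenvalues with hb
  have hU : U * Uᴴ = 1 := eigU_mul hA.1
  have hV : V * Vᴴ = 1 := eigU_mul hB.1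
  have hU' : Uᴴ * U = 1 := mul_eq_one_comm.mp hU
  have hV' : Vᴴ * V = 1 := mul_eq_one_comm.mp hV
  have eA : A = specForm U a := eq_specForm hA.1
  have eB : B = specForm V b := eq_specForm hB.1
  have lA : matLog A = specForm U (fun i => Real.log (a i)) := matFun_eq hA.1 _
  have lB : matLog B = specForm V (fun i => Real.log (b i)) := matFun_eq hB.1 _
  have hai : ∀ i, 0 < a i := hA.eigenvalues_pos
  have hbj : ∀ i, 0 < b i := hB.eigenvalues_pos
  set W := Uᴴ * V with hW
  have h1 : A.trace.re = ∑ i, ∑ j, a i * 1 * Complex.normSq (W i j) := by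
    rw [← trace_specForm_mul, specForm_one hV, Matrix.mul_one, ← eA]
  have h3 : ((A * matLog A).trace).re =
      ∑ i, ∑ j, a i * Real.log (a i) * 1 * Complex.normSq (W i j) := by
    rw [← trace_specForm_mul, specForm_one hV, Matrix.mul_one, lA]
    conv_lhs => rw [eA]
    rw [specForm_mul hU]
  have h4 : ((A * matLog B).trace).re =
      ∑ i, ∑ j, a i * Real.log (b j) * Complex.normSq (W i j) := by
    rw [← trace_specForm_mul, ← eA, lB]
  have hrow : ∀ i, ∑ j, Complex.normSq (W i j) = 1 := by
    intro i
    have hWW : W * Wᴴ = 1 := by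
      rw [hW, Matrix.conjTranspose_mul, Matrix.conjTranspose_conjTranspose]
      calc _ = Uᴴ * (V * Vᴴ) * U := by simp only [Matrix.mul_assoc]
        _ = 1 := by rw [hV, Matrix.mul_one, hU']
    have := congrFun (congrFun hWW i) i
    rw [Matrix.mul_apply, Matrix.one_apply_eq] at this
    have h5 : ((∑ j, Complex.normSq (W i j) : ℝ) : ℂ) = 1 := by
      rw [← this]
      push_cast
      apply Finset.sum_congr rfl
      intro j _
      rw [Matrix.conjTranspose_apply, Complex.normSq_eq_conj_mul_self, mul_comm]; rfl
    exact_mod_cast h5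
  -- the conjugated inequality
  have hpsd : ((v : ℂ) • Matrix.diagonal (fun i => (b i : ℂ)) -
      Wᴴ * Matrix.diagonal (fun i => (a i : ℂ)) * W).PosSemidef := by
    have := hAB.conjTranspose_mul_mul_same V
    convert this using 1
    rw [Matrix.mul_sub, Matrix.sub_mul, Matrix.mul_smul, Matrix.smul_mul]
    congr 1
    · conv_rhs => rw [eB]
      unfold specForm
      simp only [← Matrix.mul_assoc]
      rw [hV', Matrix.one_mul, Matrix.mul_assoc, hV', Matrix.mul_one]
    · conv_rhs => rw [eA]
      unfold specForm
      rw [hW, Matrix.conjTranspose_mul, Matrix.conjTranspose_conjTranspose]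
      simp only [Matrix.mul_assoc]
  have hS : ∀ i, a i * ∑ j, Complex.normSq (W i j) / b j ≤ v := by
    intro i
    set S := ∑ j, Complex.normSq (W i j) / b j with hSdef
    have hS0 : 0 ≤ S := Finset.sum_nonneg fun j _ =>
      div_nonneg (Complex.normSq_nonneg _) (hbj j).le
    set x : m → ℂ := fun j => star (W i j) / (b j : ℂ) with hx
    have h6 := hpsd.re_dotProduct_nonneg x
    rw [Matrix.sub_mulVec, dotProduct_sub, map_sub] at h6
    have e1 : star x ⬝ᵥ (((v : ℂ) • Matrix.diagonal (fun i => (b i : ℂ))) *ᵥ x) =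
        ((v * S : ℝ) : ℂ) := by
      rw [Matrix.smul_mulVec, dotProduct_smul, Complex.ofReal_mul, smul_eq_mul]
      congr 1
      rw [dotProduct, hSdef, Complex.ofReal_sum]
      apply Finset.sum_congr rfl
      intro j _
      have : (b j : ℂ) ≠ 0 := by exact_mod_cast (hbj j).ne'
      rw [Matrix.mulVec_diagonal, Complex.ofReal_div, Complex.normSq_eq_conj_mul_self]
      simp only [hx, Pi.star_apply, star_div₀, Complex.star_def, Complex.conj_ofReal,
        Complex.conj_conj]
      field_simp
    have e2 : star x ⬝ᵥ ((Wᴴ * Matrix.diagonal (fun i => (a i : ℂ)) * W) *ᵥ x) =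
        ((∑ k, a k * Complex.normSq ((W *ᵥ x) k) : ℝ) : ℂ) := by
      rw [← Matrix.mulVec_mulVec, ← Matrix.mulVec_mulVec, Matrix.dotProduct_mulVec,
        ← Matrix.star_mulVec, dotProduct, Complex.ofReal_sum]
      apply Finset.sum_congr rfl
      intro k _
      rw [Matrix.mulVec_diagonal, Complex.ofReal_mul, Complex.normSq_eq_conj_mul_self]
      simp only [Pi.star_apply, Complex.star_def]
      ring
    have e3 : (W *ᵥ x) i = (S : ℂ) := by
      rw [Matrix.mulVec, dotProduct, hSdef, Complex.ofReal_sum]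
      apply Finset.sum_congr rfl
      intro j _
      rw [Complex.ofReal_div, Complex.normSq_eq_conj_mul_self]
      simp only [hx, Complex.star_def]
      ring
    rw [e1, e2] at h6
    simp only [RCLike.re_eq_complex_re, Complex.ofReal_re] at h6
    have h7 : a i * Complex.normSq ((W *ᵥ x) i) ≤ ∑ k, a k * Complex.normSq ((W *ᵥ x) k) :=
      Finset.single_le_sum (f := fun k => a k * Complex.normSq ((W *ᵥ x) k))
        (fun k _ => mul_nonneg (hai k).le (Complex.normSq_nonneg _)) (Finset.mem_univ i)
    rw [e3, Complex.normSq_ofReal] at h7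
    rcases hS0.eq_or_lt with h0 | h0
    · rw [← h0]; simpa using hv.le
    · have : (a i * S) * S ≤ v * S := by nlinarith
      exact le_of_mul_le_mul_right this h0
  rw [h1, h3, h4, Finset.sum_mul]
  simp only [← Finset.sum_sub_distrib]
  apply Finset.sum_le_sum; intro i _
  have h8 : ∀ j ∈ Finset.univ, a i * Real.log (a i) * 1 * Complex.normSq (W i j) -
      a i * Real.log (b j) * Complex.normSq (W i j) ≤
      a i * ((Real.log v - 1) * Complex.normSq (W i j) +
        a i / v * (Complex.normSq (W i j) / b j)) := by
    intro j _
    have hi := hai i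
    have hj := hbj j
    have hl : Real.log (a i) - Real.log (b j) ≤ Real.log v - 1 + a i / v / b j := by
      have := Real.log_le_sub_one_of_pos (x := a i / (v * b j)) (by positivity)
      rw [Real.log_div hi.ne' (by positivity), Real.log_mul hv.ne' hj.ne', ← div_div] at this
      linarith
    have := mul_le_mul_of_nonneg_left (mul_le_mul_of_nonneg_right hl
      (Complex.normSq_nonneg (W i j))) hi.le
    calc _ = a i * ((Real.log (a i) - Real.log (b j)) * Complex.normSq (W i j)) := by ring
      _ ≤ _ := this
      _ = _ := by ring
  refine (Finset.sum_le_sum h8).trans ?_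
  rw [← Finset.mul_sum, Finset.sum_add_distrib, ← Finset.mul_sum, ← Finset.mul_sum,
    ← Finset.mul_sum, hrow]
  have h9 : a i / v * ∑ j, Complex.normSq (W i j) / b j ≤ 1 := by
    rw [div_mul_eq_mul_div, div_le_one hv]; exact hS i
  have := mul_le_mul_of_nonneg_left h9 (hai i).le
  nlinarith

end Helpers

/-! ### Tensor powers -/

section Tensor

variable {d : ℕ}

lemma tensorPow_mul (A B : Matrix (Fin d) (Fin d) ℂ) (n : ℕ) :
    tensorPow (A * B) n = tensorPow A n * tensorPow B n := by
  ext x y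
  simp only [tensorPow, Matrix.mul_apply]
  rw [Finset.prod_univ_sum, Fintype.piFinset_univ]
  simp only [Finset.prod_mul_distrib]

lemma tensorPow_diagonal (a : Fin d → ℂ) (n : ℕ) :
    tensorPow (Matrix.diagonal a) n = Matrix.diagonal (fun x => ∏ i, a (x i)) := by
  ext x y
  simp only [tensorPow]
  by_cases h : x = y
  · subst h; simp
  · rw [Matrix.diagonal_apply_ne _ h]
    obtain ⟨i, hi⟩ := Function.ne_iff.mp h
    exact Finset.prod_eq_zero (Finset.mem_univ i) (Matrix.diagonal_apply_ne _ hi)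

lemma tensorPow_one (n : ℕ) : tensorPow (1 : Matrix (Fin d) (Fin d) ℂ) n = 1 := by
  rw [← Matrix.diagonal_one, tensorPow_diagonal]
  simp

lemma tensorPow_conjTranspose (A : Matrix (Fin d) (Fin d) ℂ) (n : ℕ) :
    tensorPow Aᴴ n = (tensorPow A n)ᴴ := by
  ext x y
  simp [tensorPow, Matrix.conjTranspose_apply]

lemma tensorPow_specForm (U : Matrix (Fin d) (Fin d) ℂ) (a : Fin d → ℝ) (n : ℕ) :
    tensorPow (specForm U a) n = specForm (tensorPow U n) (fun x => ∏ i, a (x i)) := by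
  rw [specForm, tensorPow_mul, tensorPow_mul, tensorPow_diagonal, tensorPow_conjTranspose,
    specForm]
  push_cast
  rfl

lemma tensorPow_unitary {U : Matrix (Fin d) (Fin d) ℂ} (hU : U * Uᴴ = 1) (n : ℕ) :
    tensorPow U n * (tensorPow U n)ᴴ = 1 := by
  rw [← tensorPow_conjTranspose, ← tensorPow_mul, hU, tensorPow_one]

lemma tensorPow_posDef {A : Matrix (Fin d) (Fin d) ℂ} (hA : A.PosDef) (n : ℕ) :
    (tensorPow A n).PosDef := by
  rw [eq_specForm hA.1, tensorPow_specForm]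
  exact specForm_posDef (tensorPow_unitary (eigU_mul hA.1) n) _
    fun x => Finset.prod_pos fun i _ => hA.eigenvalues_pos _

lemma tensorPow_trace (A : Matrix (Fin d) (Fin d) ℂ) (n : ℕ) :
    (tensorPow A n).trace = A.trace ^ n := by
  simp only [Matrix.trace, Matrix.diag_apply, tensorPow]
  rw [Fintype.sum_pow]

lemma trace_tensorPow_log {R A : Matrix (Fin d) (Fin d) ℂ} (hA : A.PosDef) (hR : R.trace = 1)
    (n : ℕ) : (tensorPow R n * matLog (tensorPow A n)).trace = n * (R * matLog A).trace := by
  set U := (hA.1.eigenvectorUnitary : Matrix (Fin d) (Fin d) ℂ)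
  set a := hA.1.eigenvalues with ha
  have hU : U * Uᴴ = 1 := eigU_mul hA.1
  have eA : A = specForm U a := eq_specForm hA.1
  have lA : matLog A = specForm U (fun i => Real.log (a i)) := matFun_eq hA.1 _
  have hai : ∀ i, 0 < a i := hA.eigenvalues_pos
  have lAn : matLog (tensorPow A n) =
      specForm (tensorPow U n) (fun x => ∑ i, Real.log (a (x i))) := by
    conv_lhs => rw [eA]
    rw [tensorPow_specForm, matLog, matFun_specForm (tensorPow_unitary hU n)]
    congr 1
    ext x
    rw [Real.log_prod fun i _ => (hai _).ne']
  set M := Uᴴ * R * U with hM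
  have hMt : ∑ k, M k k = 1 := by
    change M.trace = 1
    rw [hM, Matrix.trace_mul_comm, ← Matrix.mul_assoc, hU, Matrix.one_mul, hR]
  have hgen : ∀ {m : Type} [Fintype m] [DecidableEq m] (R U : Matrix m m ℂ) (c : m → ℝ),
      (R * specForm U c).trace = ∑ k, (Uᴴ * R * U) k k * (c k : ℂ) := by
    intro m _ _ R U c
    have : (R * specForm U c).trace =
        ((Uᴴ * R * U) * Matrix.diagonal (fun i => (c i : ℂ))).trace := by
      rw [specForm, ← Matrix.mul_assoc, Matrix.trace_mul_comm]
      simp only [Matrix.mul_assoc]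
    rw [this, Matrix.trace]
    simp only [Matrix.diag_apply, Matrix.mul_diagonal]
  rw [lA, lAn, hgen, hgen, ← tensorPow_conjTranspose, ← tensorPow_mul, ← tensorPow_mul, ← hM]
  simp only [Complex.ofReal_sum, Finset.mul_sum]
  rw [Finset.sum_comm]
  have : ∀ i : Fin n, ∑ x : Fin n → Fin d, tensorPow M n x x * (Real.log (a (x i)) : ℂ) =
      ∑ k, M k k * (Real.log (a k) : ℂ) := by
    intro i
    have e : ∀ x : Fin n → Fin d, tensorPow M n x x * (Real.log (a (x i)) : ℂ) =
        ∏ j, (M (x j) (x j) * if j = i then (Real.log (a (x j)) : ℂ) else 1) := by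
      intro x
      rw [Finset.prod_mul_distrib, Finset.prod_ite_eq' Finset.univ i]
      simp [tensorPow]
    simp only [e]
    rw [← Fintype.piFinset_univ, ← Finset.prod_univ_sum (fun _ => Finset.univ)
      (fun j k => M k k * if j = i then (Real.log (a k) : ℂ) else 1)]
    rw [Finset.prod_eq_single_of_mem i (Finset.mem_univ i)]
    · simp
    · intro j _ hj
      simp [hj, hMt]
  simp only [this]
  simp [Finset.mul_sum]

lemma numEig_tensorPow_le {A : Matrix (Fin d) (Fin d) ℂ} (hA : A.IsHermitian) (n : ℕ) :
    numEig (tensorPow A n) ≤ (n + 1) ^ d := by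
  classical
  set U := (hA.eigenvectorUnitary : Matrix (Fin d) (Fin d) ℂ)
  set a := hA.eigenvalues with ha
  have hU : U * Uᴴ = 1 := eigU_mul hA
  have eA : A = specForm U a := eq_specForm hA
  have hc : (Finset.univ : Finset (Fin d → Fin (n + 1))).card = (n + 1) ^ d := by simp
  rw [numEig, ← hc]
  apply Finset.card_le_card_of_surjOn (fun c => ∏ k, a k ^ (c k : ℕ))
  intro t ht
  rw [Finset.mem_coe, eA, tensorPow_specForm] at ht
  obtain ⟨x, hx⟩ := eigFinset_subset (tensorPow_unitary hU n) _ ht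
  refine ⟨fun k => ⟨(Finset.univ.filter (fun i => x i = k)).card, ?_⟩, by simp, ?_⟩
  · have := Finset.card_le_univ (Finset.univ.filter (fun i => x i = k))
    simp only [Fintype.card_fin] at this
    omega
  · simp only
    rw [← hx]
    rw [← Finset.prod_fiberwise_of_maps_to (s := Finset.univ) (t := Finset.univ) (g := x)
      (fun _ _ => Finset.mem_univ _)]
    apply Finset.prod_congr rfl
    intro k _
    rw [Finset.prod_congr rfl (g := fun _ => a k)
      (fun i hi => by rw [(Finset.mem_filter.mp hi).2]), Finset.prod_const]

end Tensor

/-- **Pinching achieves the relative entropy asymptotically.**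
`(1/n) D(E_{σ_n}(ρ_n)‖σ_n) → D(ρ‖σ)`. -/
theorem pinching_achieves_relEnt {d : ℕ} (hd : 0 < d) (ρ σ : Matrix (Fin d) (Fin d) ℂ)
    (hρ : IsDensity ρ) (hσ : IsDensity σ) (hρpd : ρ.PosDef) (hσpd : σ.PosDef) :
    Tendsto (fun n : ℕ => (1 / (n : ℝ)) *
        relEnt (pinch (tensorPow σ n) (tensorPow ρ n)) (tensorPow σ n))
      atTop (nhds (relEnt ρ σ)) := by
  have hv0 : ∀ n, 0 < numEig (tensorPow σ n) := by
    classical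
    intro n
    rw [numEig, eigFinset, dif_pos (tensorPow_posDef hσpd n).1, Finset.card_pos]
    exact ⟨_, Finset.mem_image_of_mem _ (Finset.mem_univ (fun _ => ⟨0, hd⟩))⟩
  have main : ∀ n : ℕ,
      relEnt (pinch (tensorPow σ n) (tensorPow ρ n)) (tensorPow σ n) ≤ n * relEnt ρ σ ∧
      n * relEnt ρ σ - d * Real.log (n + 1) ≤
        relEnt (pinch (tensorPow σ n) (tensorPow ρ n)) (tensorPow σ n) := by
    intro n
    have hS := tensorPow_posDef hσpd n
    have hR := tensorPow_posDef hρpd n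
    have hP := pinch_posDef hS.1 hR (hv0 n)
    have hPt : (pinch (tensorPow σ n) (tensorPow ρ n)).trace = (tensorPow ρ n).trace := by
      have := trace_pinch_mul hS.1 (tensorPow ρ n) 1 (by simp)
      simpa using this
    have hRt : (tensorPow ρ n).trace = 1 := by rw [tensorPow_trace, hρ.2, one_pow]
    have e1 : relEnt ρ σ = ((ρ * matLog ρ).trace).re - ((ρ * matLog σ).trace).re := by
      rw [relEnt, Matrix.mul_sub, Matrix.trace_sub, Complex.sub_re]
    have t1 := congrArg Complex.re (trace_tensorPow_log hρpd hρ.2 n)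
    have t2 := congrArg Complex.re (trace_tensorPow_log hσpd hρ.2 n)
    rw [← Complex.ofReal_natCast, Complex.re_ofReal_mul] at t1 t2
    have e2 : relEnt (pinch (tensorPow σ n) (tensorPow ρ n)) (tensorPow σ n) =
        ((tensorPow ρ n * matLog (pinch (tensorPow σ n) (tensorPow ρ n))).trace).re -
        ((tensorPow ρ n * matLog (tensorPow σ n)).trace).re := by
      rw [relEnt, Matrix.mul_sub, Matrix.trace_sub, Complex.sub_re, trace_pinch_mul hS.1,
        trace_pinch_mul hS.1]
      · intro t _
        apply commute_matFun hS.1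
        exact (commute_matFun hS.1 rfl _).symm
      · intro t ht
        exact commute_matFun hP.1 (pinch_comm hS.1 _ ht) _
    have k := klein hR hP
    have u := upper_of_le hR hP (v := (numEig (tensorPow σ n) : ℝ))
      (by exact_mod_cast hv0 n) (pinch_ineq hS.1 hR.posSemidef)
    rw [hPt] at k
    rw [hRt, Complex.one_re, one_mul] at u
    have hlog : Real.log (numEig (tensorPow σ n)) ≤ d * Real.log (n + 1) := by
      rw [← Real.log_pow]
      apply Real.log_le_log (by exact_mod_cast hv0 n)
      exact_mod_cast numEig_tensorPow_le hσpd.1 n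
    rw [e2, e1]
    constructor <;> nlinarith
  have hlim : Tendsto (fun n : ℕ => relEnt ρ σ - d * (Real.log (n + 1) / n)) atTop
      (nhds (relEnt ρ σ)) := by
    have h0 : Tendsto (fun n : ℕ => Real.log (n + 1) / n) atTop (nhds 0) := by
      have h1 := (Real.isLittleO_log_id_atTop.tendsto_div_nhds_zero).comp
        (tendsto_atTop_add_const_right atTop (1 : ℝ) tendsto_natCast_atTop_atTop)
      have h2 : Tendsto (fun n : ℕ => ((n : ℝ) + 1) / n) atTop (nhds 1) := by
        have h3 : Tendsto (fun n : ℕ => 1 + 1 / (n : ℝ)) atTop (nhds (1 + 0)) :=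
          tendsto_const_nhds.add tendsto_one_div_atTop_nhds_zero_nat
        rw [add_zero] at h3
        refine h3.congr' ?_
        filter_upwards [eventually_gt_atTop 0] with n hn
        field_simp
      have h4 := h1.mul h2
      rw [zero_mul] at h4
      refine h4.congr' ?_
      filter_upwards [eventually_gt_atTop 0] with n hn
      simp only [Function.comp, id]
      field_simp
    simpa using tendsto_const_nhds.sub (h0.const_mul (d : ℝ))
  refine tendsto_of_tendsto_of_tendsto_of_le_of_le' hlim tendsto_const_nhds ?_ ?_
  · filter_upwards [eventually_gt_atTop 0] with n hn
    have hn' : (0 : ℝ) < n := by exact_mod_cast hn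
    have := mul_le_mul_of_nonneg_left (main n).2 (by positivity : (0 : ℝ) ≤ 1 / n)
    refine le_trans (le_of_eq ?_) this
    field_simp
  · filter_upwards [eventually_gt_atTop 0] with n hn
    have hn' : (0 : ℝ) < n := by exact_mod_cast hn
    have := mul_le_mul_of_nonneg_left (main n).1 (by positivity : (0 : ℝ) ≤ 1 / n)
    refine le_trans this (le_of_eq ?_)
    field_simp

end
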